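/- arXiv:2402.07847 — 7 statements merged into one kernel-verified Lean document; each statement's English description precedes it below -/
import Mathlib

section
/- Let (J¹π, Ω_L) be a hyper-regular first-order Lagrangian system with Lagrangian density L = 𝓛 d^m x and Legendre map FL: J¹π → J¹π* a global diffeomorphism. Let ξ_E be a π-projectable vector field on E, X_ξ = j¹ξ_E its 1-jet prolongation to J¹π, and Y_ξ its canonical lift to J¹π*. If L(X_ξ)L = 0, then FL_* X_ξ = Y_ξ. -/
/-!
First-order jet bundle `J¹π` of the trivialized configuration bundle
`π : E = M × F → M`, in natural coordinates `(xᵘ, yᴬ, yᴬ_μ)` (`m = k+1`,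
`1 ≤ A ≤ n`), and the restricted multimomentum bundle `J¹π*` in coordinates
`(xᵘ, yᴬ, p_Aᵘ)`.  Forms are represented by their pointwise evaluation
functions and the Lie derivative is given by Cartan's formula.
-/

noncomputable section

/-- Evaluation of the wedge product of `j` covectors on `j` vectors. -/
def wedgeEval {V : Type*} {j : ℕ} (ℓ : Fin j → V → ℝ) (v : Fin j → V) : ℝ :=
  (Matrix.of fun i s => ℓ s (v i)).det

/-- Pointwise evaluation of the exterior derivative of a `j`-form. -/
def extDerEval {V : Type*} [NormedAddCommGroup V] [NormedSpace ℝ V] {j : ℕ}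
    (ω : V → (Fin j → V) → ℝ) (x : V) (v : Fin (j+1) → V) : ℝ :=
  ∑ i : Fin (j+1), (-1 : ℝ) ^ (i : ℕ) * fderiv ℝ (fun y => ω y (v ∘ i.succAbove)) x (v i)

/-- Lie derivative of a `(j+1)`-form along a vector field (Cartan's formula). -/
def lieEval {V : Type*} [NormedAddCommGroup V] [NormedSpace ℝ V] {j : ℕ}
    (X : V → V) (ω : V → (Fin (j+1) → V) → ℝ) (x : V) (v : Fin (j+1) → V) : ℝ :=
  extDerEval ω x (Fin.cons (X x) v) +
    extDerEval (fun y (w : Fin j → V) => ω y (Fin.cons (X y) w)) x v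

/-- Configuration space `E` in coordinates `(xᵘ, yᴬ)`. -/
abbrev Eco (k n : ℕ) := (Fin (k+1) → ℝ) × (Fin n → ℝ)

/-- The jet bundle `J¹π` in coordinates `(xᵘ, yᴬ, yᴬ_μ)`. -/
abbrev J1 (k n : ℕ) := (Fin (k+1) → ℝ) × (Fin n → ℝ) × (Fin n → Fin (k+1) → ℝ)

/-- The restricted multimomentum bundle `J¹π*` in coordinates `(xᵘ, yᴬ, p_Aᵘ)`. -/
abbrev J1S (k n : ℕ) := (Fin (k+1) → ℝ) × (Fin n → ℝ) × (Fin n → Fin (k+1) → ℝ)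

/-- Coordinate covector `dxᵘ` on `J¹π` (for the volume form `dᵐx`). -/
def dxJ (k n : ℕ) (μ : Fin (k+1)) : J1 k n → ℝ := fun v => v.1 μ

/-- The Legendre map `FL : J¹π → J¹π*` of a Lagrangian `𝓛`:
`FL*xᵛ = xᵛ`, `FL*yᴬ = yᴬ`, `FL*p_Aᵛ = ∂𝓛/∂yᴬ_ν`. -/
def LegFL (k n : ℕ) (L : J1 k n → ℝ) (q : J1 k n) : J1S k n :=
  (q.1, q.2.1, fun A μ => fderiv ℝ L q (0, 0, Pi.single A (Pi.single μ 1)))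

/-- The 1-jet prolongation `X_ξ = j¹ξ_E` of the π-projectable vector field
`ξ_E = -ξᵘ(x)∂/∂xᵘ - ξᴬ(x,y)∂/∂yᴬ`:
`X_ξ = -ξᵘ ∂/∂xᵘ - ξᴬ ∂/∂yᴬ
       - (∂ξᴬ/∂xᵘ - yᴬ_ν ∂ξᵛ/∂xᵘ + yᴮ_μ ∂ξᴬ/∂yᴮ) ∂/∂yᴬ_μ`. -/
def Xlift (k n : ℕ) (ξx : Fin (k+1) → (Fin (k+1) → ℝ) → ℝ) (ξy : Fin n → Eco k n → ℝ)
    (q : J1 k n) : J1 k n :=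
  (fun μ => -ξx μ q.1,
   fun A => -ξy A (q.1, q.2.1),
   fun A μ => -(fderiv ℝ (ξy A) (q.1, q.2.1) (Pi.single μ 1, 0)
      - (∑ ν, q.2.2 A ν * fderiv ℝ (ξx ν) q.1 (Pi.single μ 1))
      + ∑ B, q.2.2 B μ * fderiv ℝ (ξy A) (q.1, q.2.1) (0, Pi.single B 1)))

/-- The canonical lift `Y_ξ` of `ξ_E` to `J¹π*`:
`Y_ξ = -ξᵘ ∂/∂xᵘ - ξᴬ ∂/∂yᴬ
       - (∂ξᵘ/∂xᵛ p_Aᵛ - ∂ξᵛ/∂xᵛ p_Aᵘ - ∂ξᴮ/∂yᴬ p_Bᵘ) ∂/∂p_Aᵘ`. -/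
def Ylift (k n : ℕ) (ξx : Fin (k+1) → (Fin (k+1) → ℝ) → ℝ) (ξy : Fin n → Eco k n → ℝ)
    (r : J1S k n) : J1S k n :=
  (fun μ => -ξx μ r.1,
   fun A => -ξy A (r.1, r.2.1),
   fun A μ => -((∑ ν, fderiv ℝ (ξx μ) r.1 (Pi.single ν 1) * r.2.2 A ν)
      - (∑ ν, fderiv ℝ (ξx ν) r.1 (Pi.single ν 1)) * r.2.2 A μ
      - ∑ B, fderiv ℝ (ξy B) (r.1, r.2.1) (0, Pi.single A 1) * r.2.2 B μ))

/-- The determinant of the matrix with first row `a` whose other rows are the standard basis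
vectors other than the `i`-th. -/
lemma det_cons_single_succAbove {k : ℕ} (i : Fin (k + 1)) (a : Fin (k + 1) → ℝ)
    (M : Matrix (Fin (k + 1)) (Fin (k + 1)) ℝ) (h0 : ∀ s, M 0 s = a s)
    (hs : ∀ r s, M (Fin.succ r) s = (Pi.single (i.succAbove r) (1 : ℝ) : Fin (k + 1) → ℝ) s) :
    M.det = (-1 : ℝ) ^ (i : ℕ) * a i := by
  rw [Matrix.det_succ_row_zero, Finset.sum_eq_single i]
  · have : M.submatrix Fin.succ i.succAbove = 1 := by
      ext r s
      simp [hs, Matrix.one_apply, Pi.single_apply, eq_comm]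
    rw [this, Matrix.det_one, h0, mul_one]
  · intro j _ hj
    obtain ⟨s, hsj⟩ := Fin.exists_succAbove_eq (Ne.symm hj)
    rw [Matrix.det_eq_zero_of_column_eq_zero s, mul_zero]
    intro r
    rw [Matrix.submatrix_apply, hs, hsj, Pi.single_apply, if_neg]
    exact (Fin.succAbove_ne i r).symm
  · simp

/-- The coordinate frame `∂/∂xᵘ` on `J¹π`. -/
def frameJ (k n : ℕ) (μ : Fin (k + 1)) : J1 k n := (Pi.single μ 1, 0, 0)

lemma wedgeEval_frameJ (k n : ℕ) : wedgeEval (dxJ k n) (frameJ k n) = 1 := by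
  have : (Matrix.of fun i s => dxJ k n s (frameJ k n i)) = 1 := by
    ext i s
    simp [dxJ, frameJ, Matrix.one_apply, Pi.single_apply, eq_comm]
  rw [wedgeEval, this, Matrix.det_one]

lemma wedgeEval_cons_frameJ (k n : ℕ) (i : Fin (k + 1)) (u : J1 k n) :
    wedgeEval (dxJ k n) (Fin.cons u (frameJ k n ∘ i.succAbove)) = (-1 : ℝ) ^ (i : ℕ) * u.1 i :=
  det_cons_single_succAbove i u.1 _ (fun s => by simp [dxJ])
    (fun r s => by simp [dxJ, frameJ])

/-- The Lie derivative of `𝓛 dᵐx` along `X`, evaluated on the coordinate frame, is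
`X(𝓛) + 𝓛 ∂Xᵘ/∂xᵘ`. -/
lemma lieEval_density_frameJ (k n : ℕ) {L : J1 k n → ℝ} {X : J1 k n → J1 k n} {q : J1 k n}
    (hL : DifferentiableAt ℝ L q) (hX : ∀ μ, DifferentiableAt ℝ (fun p => (X p).1 μ) q) :
    lieEval X (fun p w => L p * wedgeEval (dxJ k n) w) q (frameJ k n) =
      fderiv ℝ L q (X q) +
        L q * ∑ μ, fderiv ℝ (fun p => (X p).1 μ) q (frameJ k n μ) := by
  have hc (i : Fin (k + 1)) : (Fin.cons (X q) (frameJ k n) : Fin (k + 2) → J1 k n) ∘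
      i.succ.succAbove = Fin.cons (X q) (frameJ k n ∘ i.succAbove) := by
    ext1 r
    refine Fin.cases ?_ (fun r => ?_) r <;> simp
  have h0 : (Fin.cons (X q) (frameJ k n) : Fin (k + 2) → J1 k n) ∘ (0 : Fin (k + 2)).succAbove =
      frameJ k n := by
    ext1 r
    simp
  have hsq (i : Fin (k + 1)) : (-1 : ℝ) ^ (i : ℕ) * (-1 : ℝ) ^ (i : ℕ) = 1 := by
    rw [← mul_pow]; simp
  unfold lieEval extDerEval
  rw [Fin.sum_univ_succ, h0]
  simp only [hc, wedgeEval_frameJ, wedgeEval_cons_frameJ, Fin.cons_zero, Fin.cons_succ, Fin.val_zero, pow_zero,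
    one_mul, mul_one, Fin.val_succ]
  rw [add_assoc, ← Finset.sum_add_distrib, Finset.mul_sum]
  congr 1
  refine Finset.sum_congr rfl fun i _ => ?_
  rw [fderiv_mul_const hL, fderiv_fun_mul hL ((hX i).const_mul _), fderiv_const_mul (hX i)]
  simp only [add_apply, smul_apply, smul_eq_mul, pow_succ]
  linear_combination (L q * fderiv ℝ (fun p => (X p).1 i) q (frameJ k n i)) * hsq i

/-- The fibre direction `∂/∂yᴬ_μ` on `J¹π`. -/
def velJ (k n : ℕ) (A : Fin n) (μ : Fin (k + 1)) : J1 k n := (0, 0, Pi.single A (Pi.single μ 1))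

lemma map_vertical (k n : ℕ) (f : J1 k n →L[ℝ] ℝ) (W : Fin n → Fin (k + 1) → ℝ) :
    f (0, 0, W) = ∑ B, ∑ ν, W B ν * f (velJ k n B ν) := by
  have : ((0, 0, W) : J1 k n) = ∑ B, ∑ ν, W B ν • velJ k n B ν := by
    refine Prod.ext ?_ (Prod.ext ?_ ?_)
    · simp [Prod.fst_sum, velJ]
    · simp [Prod.fst_sum, Prod.snd_sum, velJ]
    · ext B ν
      simp [Prod.snd_sum, velJ, Finset.sum_apply, Pi.single_apply, ite_apply]
  rw [this]
  simp only [map_sum, map_smul, smul_eq_mul]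

/-- The variation of the prolongation `X_ξ` in the direction `∂/∂yᴬ_μ`. -/
def XliftVar (k n : ℕ) (ξx : Fin (k+1) → (Fin (k+1) → ℝ) → ℝ) (ξy : Fin n → Eco k n → ℝ)
    (q : J1 k n) (A : Fin n) (μ : Fin (k + 1)) (B : Fin n) (ν : Fin (k + 1)) : ℝ :=
  (if B = A then fderiv ℝ (ξx μ) q.1 (Pi.single ν 1) else 0) -
    if ν = μ then fderiv ℝ (ξy B) (q.1, q.2.1) (0, Pi.single A 1) else 0

lemma Xlift_add_smul_velJ (k n : ℕ) (ξx : Fin (k+1) → (Fin (k+1) → ℝ) → ℝ)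
    (ξy : Fin n → Eco k n → ℝ) (q : J1 k n) (A : Fin n) (μ : Fin (k + 1)) (t : ℝ) :
    Xlift k n ξx ξy (q + t • velJ k n A μ) =
      Xlift k n ξx ξy q + t • ((0, 0, XliftVar k n ξx ξy q A μ) : J1 k n) := by
  refine Prod.ext ?_ (Prod.ext ?_ ?_)
  · simp [Xlift, velJ]
  · simp [Xlift, velJ]
  · ext B ν
    have h1 : ∑ ρ, (Pi.single A (Pi.single μ (1 : ℝ)) : Fin n → Fin (k + 1) → ℝ) B ρ *
        fderiv ℝ (ξx ρ) q.1 (Pi.single ν 1) =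
        if B = A then fderiv ℝ (ξx μ) q.1 (Pi.single ν 1) else 0 := by
      by_cases h : B = A
      · subst h; simp [Pi.single_apply]
      · simp [h]
    have h2 : ∑ C, (Pi.single A (Pi.single μ (1 : ℝ)) : Fin n → Fin (k + 1) → ℝ) C ν *
        fderiv ℝ (ξy B) (q.1, q.2.1) (0, Pi.single C 1) =
        if ν = μ then fderiv ℝ (ξy B) (q.1, q.2.1) (0, Pi.single A 1) else 0 := by
      rw [Finset.sum_eq_single A]
      · simp [Pi.single_apply]
      · intro C _ hC
        simp [hC]
      · simp
    simp only [Xlift, velJ, XliftVar, Prod.fst_add, Prod.snd_add, Prod.smul_fst, Prod.smul_snd,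
      smul_zero, add_zero, Pi.add_apply, Pi.smul_apply, smul_eq_mul, add_mul, mul_assoc,
      Finset.sum_add_distrib, ← Finset.mul_sum, h1, h2]
    ring

lemma sum_XliftVar_mul (k n : ℕ) (ξx : Fin (k+1) → (Fin (k+1) → ℝ) → ℝ)
    (ξy : Fin n → Eco k n → ℝ) (q : J1 k n) (A : Fin n) (μ : Fin (k + 1))
    (p : Fin n → Fin (k + 1) → ℝ) :
    ∑ B, ∑ ν, XliftVar k n ξx ξy q A μ B ν * p B ν =
      ∑ ν, fderiv ℝ (ξx μ) q.1 (Pi.single ν 1) * p A ν -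
        ∑ B, fderiv ℝ (ξy B) (q.1, q.2.1) (0, Pi.single A 1) * p B μ := by
  simp only [XliftVar, sub_mul, Finset.sum_sub_distrib, ite_mul, zero_mul, Finset.sum_ite_eq',
    Finset.mem_univ, if_true]
  congr 1
  rw [Finset.sum_comm]
  simp

/-- If `DL` along an affine family of vectors `u + t w` based at `q + t e` equals `c L`, then the
derivative of this relation at `t = 0` expresses the second derivative `D²L(u, e)`. -/
lemma fderiv_fderiv_of_forall_line {E : Type*} [NormedAddCommGroup E] [NormedSpace ℝ E]
    {L : E → ℝ} (hL : ContDiff ℝ 2 L) {q e u w : E} {c : ℝ}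
    (h : ∀ t : ℝ, fderiv ℝ L (q + t • e) (u + t • w) = L (q + t • e) * c) :
    fderiv ℝ (fderiv ℝ L) q u e = fderiv ℝ L q e * c - fderiv ℝ L q w := by
  have hline (u v : E) : HasDerivAt (fun t : ℝ => u + t • v) v 0 := by
    simpa using ((hasDerivAt_id (0 : ℝ)).smul_const v).const_add u
  have hdL : HasFDerivAt (fderiv ℝ L) (fderiv ℝ (fderiv ℝ L) q) (q + (0 : ℝ) • e) := by
    simpa using ((hL.fderiv_right (m := 1) (by norm_num)).differentiable (by norm_num) q).hasFDerivAt
  have hL1 : HasFDerivAt L (fderiv ℝ L q) (q + (0 : ℝ) • e) := by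
    simpa using (hL.differentiable (by norm_num) q).hasFDerivAt
  have h1 : HasDerivAt (fun t : ℝ => fderiv ℝ L (q + t • e) (u + t • w))
      (fderiv ℝ (fderiv ℝ L) q e u + fderiv ℝ L q w) 0 := by
    have hc : HasDerivAt (fun t : ℝ => fderiv ℝ L (q + t • e)) (fderiv ℝ (fderiv ℝ L) q e) 0 :=
      hdL.comp_hasDerivAt (0 : ℝ) (hline q e)
    have := hc.clm_apply (hline u w)
    rwa [zero_smul, zero_smul, add_zero, add_zero] at this
  have h2 : HasDerivAt (fun t : ℝ => L (q + t • e) * c) (fderiv ℝ L q e * c) 0 :=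
    (hL1.comp_hasDerivAt (0 : ℝ) (hline q e)).mul_const c
  rw [funext h] at h1
  have hsymm : IsSymmSndFDerivAt ℝ L q := hL.contDiffAt.isSymmSndFDerivAt (by simp)
  rw [hsymm.eq u e, ← h1.unique h2, add_sub_cancel_right]

/-- Differentiating `X_ξ(𝓛) = 𝓛 ∂ξᵘ/∂xᵘ` in the direction `∂/∂yᴬ_μ`. -/
lemma fderiv_fderiv_Xlift_velJ (k n : ℕ) {L : J1 k n → ℝ} (hL : ContDiff ℝ 2 L)
    (ξx : Fin (k+1) → (Fin (k+1) → ℝ) → ℝ) (ξy : Fin n → Eco k n → ℝ)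
    (hX : ∀ q, fderiv ℝ L q (Xlift k n ξx ξy q) =
      L q * ∑ ν, fderiv ℝ (ξx ν) q.1 (Pi.single ν 1))
    (q : J1 k n) (A : Fin n) (μ : Fin (k + 1)) :
    fderiv ℝ (fderiv ℝ L) q (Xlift k n ξx ξy q) (velJ k n A μ) =
      fderiv ℝ L q (velJ k n A μ) * ∑ ν, fderiv ℝ (ξx ν) q.1 (Pi.single ν 1) -
        fderiv ℝ L q (0, 0, XliftVar k n ξx ξy q A μ) := by
  refine fderiv_fderiv_of_forall_line hL fun t => ?_
  have hfst : (q + t • velJ k n A μ).1 = q.1 := by simp [velJ]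
  rw [← Xlift_add_smul_velJ, hX, hfst]

lemma fderiv_LegFL_apply (k n : ℕ) {L : J1 k n → ℝ} (hL : ContDiff ℝ 2 L) (q v : J1 k n) :
    fderiv ℝ (LegFL k n L) q v =
      (v.1, v.2.1, fun A μ => fderiv ℝ (fderiv ℝ L) q v (velJ k n A μ)) := by
  have hdL : HasFDerivAt (fderiv ℝ L) (fderiv ℝ (fderiv ℝ L) q) q :=
    ((hL.fderiv_right (m := 1) (by norm_num)).differentiable (by norm_num) q).hasFDerivAt
  have h3 : HasFDerivAt (fun p A μ => fderiv ℝ L p (velJ k n A μ))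
      (ContinuousLinearMap.pi fun A => ContinuousLinearMap.pi fun μ =>
        (fderiv ℝ (fderiv ℝ L) q).flip (velJ k n A μ)) q := by
    refine hasFDerivAt_pi.2 fun A => hasFDerivAt_pi.2 fun μ => ?_
    exact (ContinuousLinearMap.apply ℝ ℝ (velJ k n A μ)).hasFDerivAt.comp q hdL
  have h : HasFDerivAt (LegFL k n L) _ q :=
    hasFDerivAt_fst.prodMk ((hasFDerivAt_fst.comp q hasFDerivAt_snd).prodMk h3)
  rw [h.fderiv]
  rfl

/-- Let `(J¹π, Ω_L)` be a hyper-regular first-order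
Lagrangian system with Lagrangian density `L = 𝓛 dᵐx` and Legendre map
`FL : J¹π → J¹π*` a global diffeomorphism.  Let `ξ_E` be a π-projectable
vector field on `E`, `X_ξ = j¹ξ_E` its 1-jet prolongation to `J¹π` and `Y_ξ`
its canonical lift to `J¹π*`.  If `L(X_ξ)L = 0`, then `FL_* X_ξ = Y_ξ`. -/
theorem stmt6 (k n : ℕ)
    (L : J1 k n → ℝ) (hL : ContDiff ℝ (⊤:ℕ∞) L)
    (ξx : Fin (k+1) → (Fin (k+1) → ℝ) → ℝ) (ξy : Fin n → Eco k n → ℝ)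
    (hξx : ∀ μ, ContDiff ℝ (⊤:ℕ∞) (ξx μ)) (hξy : ∀ A, ContDiff ℝ (⊤:ℕ∞) (ξy A))
    -- hyper-regularity: FL is a global diffeomorphism
    (hbij : Function.Bijective (LegFL k n L))
    (hdiffeo : ∃ G : J1S k n → J1 k n, ContDiff ℝ (⊤:ℕ∞) G ∧
      Function.LeftInverse G (LegFL k n L) ∧ Function.RightInverse G (LegFL k n L))
    -- invariance of the Lagrangian density: L(X_ξ)(𝓛 dᵐx) = 0
    (hinv : ∀ (q : J1 k n) (v : Fin (k+1) → J1 k n),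
      lieEval (Xlift k n ξx ξy) (fun p w => L p * wedgeEval (dxJ k n) w) q v = 0) :
    ∀ q : J1 k n, fderiv ℝ (LegFL k n L) q (Xlift k n ξx ξy q) =
      Ylift k n ξx ξy (LegFL k n L q) := by
  have hL2 : ContDiff ℝ 2 L := hL.of_le (WithTop.coe_le_coe.2 le_top)
  have hX (q : J1 k n) : fderiv ℝ L q (Xlift k n ξx ξy q) =
      L q * ∑ ν, fderiv ℝ (ξx ν) q.1 (Pi.single ν 1) := by
    have hd (μ) : HasFDerivAt (fun p => (Xlift k n ξx ξy p).1 μ)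
        (-(fderiv ℝ (ξx μ) q.1 ∘L ContinuousLinearMap.fst ℝ _ ((Fin n → ℝ) × (Fin n → Fin (k+1) → ℝ)))) q :=
      ((((hξx μ).differentiable (by simp) q.1).hasFDerivAt).comp q hasFDerivAt_fst).neg
    have h := hinv q (frameJ k n)
    rw [lieEval_density_frameJ k n (hL2.differentiable (by norm_num) q)
      fun μ => (hd μ).differentiableAt] at h
    simp only [(hd _).fderiv] at h
    simp only [frameJ, neg_apply, ContinuousLinearMap.comp_apply,
      ContinuousLinearMap.coe_fst', Finset.sum_neg_distrib] at h
    linear_combination h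
  intro q
  rw [fderiv_LegFL_apply k n hL2]
  refine Prod.ext rfl (Prod.ext rfl ?_)
  ext A μ
  have h := fderiv_fderiv_Xlift_velJ k n hL2 ξx ξy hX q A μ
  rw [map_vertical, sum_XliftVar_mul k n ξx ξy q A μ fun B ν => fderiv ℝ L q (velJ k n B ν)] at h
  simp only [Ylift, LegFL]
  simp only [velJ] at h ⊢
  linear_combination h
end
end

section
/- (Noether's Theorem, Hamiltonian version.) Let (J¹π*, Ω_H) be a regular Hamiltonian system and Y ∈ 𝔛(J¹π*) an infinitesimal Noether symmetry with i(Y)Ω_H = −dα_Y on an open set U ⊂ J¹π*, for some α_Y ∈ Ω^{m−1}(U). Then for every locally decomposable, τ̄-transverse multivector field X_H ∈ 𝔛^m(J¹π*) solving i(X_H)Ω_H = 0, the Lie derivative L(X_H)α_Y = 0; in particular α_Y is a conserved quantity. -/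
/-!
Noether's theorem for a regular Hamiltonian system `(J¹π*, Ω_H)`.  The
restricted multimomentum bundle is modelled (in a global chart) as a product
`V = B × F` of normed spaces, with `τ̄ = pr₁ : V → B` the projection onto the
(`m = k+1`)-dimensional base.  Forms are represented by their pointwise
evaluation functions; `Ω_H = -dΘ_H`; contraction of a decomposable
`m`-multivector field `X_H = X₀ ∧ ⋯ ∧ X_{m-1}` with a form inserts
`X₀,…,X_{m-1}` into the first slots; the Lie derivative of a form `α` by a
multivector field is the graded bracket `L(X)α = (d∘i(X) - (-1)^m i(X)∘d)α`,
where `i(X)α = 0` in degree `m-1 < m`.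
-/

noncomputable section

/-- The Hamilton–Cartan `(m+1)`-form `Ω_H = -dΘ_H`. -/
def OmegaOf {V : Type*} [NormedAddCommGroup V] [NormedSpace ℝ V] {j : ℕ}
    (Θ : V → (V [⋀^Fin (j+1)]→ₗ[ℝ] ℝ)) (x : V) (v : Fin (j+2) → V) : ℝ :=
  - extDerEval (fun y => ⇑(Θ y)) x v

theorem AlternatingMap.map_snoc_eq_neg_one_pow_mul_map_cons {V : Type*} [AddCommGroup V]
    [Module ℝ V] {k : ℕ} (f : V [⋀^Fin (k+1)]→ₗ[ℝ] ℝ) (w : V) (u : Fin k → V) :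
    f (Fin.snoc u w) = (-1 : ℝ) ^ k * f (Fin.cons w u) := by
  have h : (Fin.snoc u w : Fin (k+1) → V) = (Fin.cons w u : Fin (k+1) → V) ∘ finRotate (k+1) :=
    Fin.snoc_eq_cons_rotate u w
  rw [h, f.map_perm, sign_finRotate]
  simp [Units.smul_def]

theorem Fin.snoc_comp_succAbove_castSucc {V : Type*} {k : ℕ} (w : V) (u : Fin (k+1) → V)
    (j : Fin (k+1)) :
    (Fin.snoc u w : Fin (k+2) → V) ∘ j.castSucc.succAbove = Fin.snoc (j.removeNth u) w := by
  ext i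
  refine Fin.lastCases ?_ (fun i => ?_) i <;> simp [Fin.removeNth]

theorem extDerEval_snoc {V : Type*} [NormedAddCommGroup V] [NormedSpace ℝ V] {k : ℕ}
    (Θ : V → (V [⋀^Fin (k+1)]→ₗ[ℝ] ℝ)) (x w : V) (u : Fin (k+1) → V) :
    extDerEval (fun y => ⇑(Θ y)) x (Fin.snoc u w) =
      (-1 : ℝ) ^ (k+1) * extDerEval (fun y => ⇑(Θ y)) x (Fin.cons w u) := by
  have hlast : (Fin.snoc u w : Fin (k+2) → V) ∘ (Fin.last (k+1)).succAbove = u := by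
    ext i; simp
  have hzero : (Fin.cons w u : Fin (k+2) → V) ∘ (0 : Fin (k+2)).succAbove = u := by
    ext i; simp
  unfold extDerEval
  rw [Fin.sum_univ_castSucc, Fin.sum_univ_succ (n := k+1), hlast, hzero, mul_add, add_comm,
    Finset.mul_sum]
  congr 1
  · simp
  · refine Finset.sum_congr rfl fun j _ => ?_
    rw [Fin.snoc_comp_succAbove_castSucc, Fin.cons_comp_succ_succAbove]
    simp only [AlternatingMap.map_snoc_eq_neg_one_pow_mul_map_cons, Fin.snoc_castSucc,
      Fin.cons_succ, Fin.val_castSucc, Fin.val_succ]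
    rw [show ∀ g : V → ℝ, (fun y => (-1 : ℝ) ^ k * g y) = (-1 : ℝ) ^ k • g from fun _ => rfl,
      fderiv_const_smul_field]
    simp only [Pi.smul_apply, ContinuousLinearMap.smul_apply, smul_eq_mul, pow_succ]
    ring

/-- **Noether's theorem, Hamiltonian version.**  Let
`(J¹π*, Ω_H)` be a regular Hamiltonian system and `Y` an infinitesimal
Noether symmetry with `i(Y)Ω_H = -dα_Y` on an open set `U`, for some
`(m-1)`-form `α_Y`.  Then for every locally decomposable, `τ̄`-transverse
multivector field `X_H = X₀ ∧ ⋯ ∧ X_{m-1}` solving `i(X_H)Ω_H = 0`, the Lie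
derivative `L(X_H)α_Y = (d∘i(X_H) - (-1)^m i(X_H)∘d)α_Y` vanishes (here
`i(X_H)α_Y = 0` since `deg α_Y = m-1 < m`); in particular `α_Y` is a
conserved quantity. -/
theorem stmt9 (k : ℕ) {B F : Type*}
    [NormedAddCommGroup B] [NormedSpace ℝ B]
    [NormedAddCommGroup F] [NormedSpace ℝ F]
    -- the Hamilton–Cartan m-form Θ_H on J¹π* = B × F, smooth
    (Θ : B × F → ((B × F) [⋀^Fin (k+1)]→ₗ[ℝ] ℝ))
    (hΘ : ∀ v : Fin (k+1) → B × F, ContDiff ℝ (⊤:ℕ∞) (fun y => Θ y v))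
    -- regularity: Ω_H = -dΘ_H is 1-nondegenerate
    (hreg : ∀ (x : B × F) (w : B × F),
      (∀ v : Fin (k+1) → B × F, OmegaOf Θ x (Fin.cons w v) = 0) → w = 0)
    -- Y is an infinitesimal Noether symmetry: L(Y)Ω_H = 0
    (Y : B × F → B × F) (hYsm : ContDiff ℝ (⊤:ℕ∞) Y)
    (hY : ∀ (x : B × F) (v : Fin (k+2) → B × F), lieEval Y (OmegaOf Θ) x v = 0)
    -- the conserved quantity α_Y, with i(Y)Ω_H = -dα_Y on the open set U
    (U : Set (B × F)) (hU : IsOpen U)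
    (α : B × F → ((B × F) [⋀^Fin k]→ₗ[ℝ] ℝ))
    (hαsm : ∀ v : Fin k → B × F, ContDiff ℝ (⊤:ℕ∞) (fun y => α y v))
    (hα : ∀ x ∈ U, ∀ v : Fin (k+1) → B × F,
      OmegaOf Θ x (Fin.cons (Y x) v) = -extDerEval (fun y => ⇑(α y)) x v)
    -- a locally decomposable multivector field X_H = X₀ ∧ ⋯ ∧ X_{m-1} …
    (X : Fin (k+1) → B × F → B × F)
    -- … which is τ̄-transverse …
    (htrans : ∀ β : B → (B [⋀^Fin (k+1)]→ₗ[ℝ] ℝ), (∀ b, β b ≠ 0) →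
      ∀ x : B × F, β x.1 (fun i => (X i x).1) ≠ 0)
    -- … and a solution of the field equations i(X_H)Ω_H = 0:
    (hsol : ∀ (x : B × F) (w : B × F),
      OmegaOf Θ x (Fin.snoc (fun i => X i x) w) = 0) :
    -- conclusion: L(X_H)α_Y = d(i(X_H)α_Y) - (-1)^m i(X_H)(dα_Y) = 0 on U
    ∀ x ∈ U,
      (0 : ℝ) - (-1 : ℝ)^(k+1) *
        extDerEval (fun y => ⇑(α y)) x (fun i => X i x) = 0 := by
  intro x hx
  have h := hsol x (Y x)
  rw [OmegaOf, extDerEval_snoc] at h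
  have h' := hα x hx (fun i => X i x)
  rw [OmegaOf] at h'
  rw [← neg_inj.mp h', zero_sub]
  exact h
end
end

section
/- The variation of the Polyakov Lagrangian with respect to the inverse worldsheet metric produces the Hilbert stress–energy tensor: regarding 𝓛(g^{··}, x^·_·) = −(T/2)√(−det g) η_{μν} g^{ab} x^μ_a x^ν_b as a smooth function of the entries g^{ab} of the inverse of a symmetric 2×2 matrix g with det g < 0, one has ∂𝓛/∂g^{ab} = −(T/2)√(−det g) (η_{μν} x^μ_a x^ν_b − ½ g_{ab} g^{cd} η_{μν} x^μ_c x^ν_d), i.e. −(2/T)(1/√(−det g)) ∂𝓛/∂g^{ab} = T_{ab}; equivalently, ∂√(−det g)/∂g^{ab} = −½ √(−det g) g_{ab}. -/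
/-!
The variation of the Polyakov Lagrangian with respect to the entries of the
inverse worldsheet metric.  The independent variables are the entries
`h = (g^{ab})` of the inverse of a symmetric 2×2 matrix `g` with `det g < 0`;
`g_{ab}` denotes the entries of the inverse matrix `(Matrix.of h)⁻¹`, which
depend smoothly on `h`.  Worldsheet indices `a,b,c,d` run over `Fin 2`,
spacetime indices `μ,ν` over `Fin D`.
-/

noncomputable section

/-- The Minkowski metric `η` on `ℝᴰ`, with signature `(-+…+)`. -/
def mink (D : ℕ) : Fin D → Fin D → ℝ :=
  fun μ ν => if μ = ν then (if (μ : ℕ) = 0 then -1 else 1) else 0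

/-- `√(-det g)` as a function of the entries `h = (g^{ab})` of the inverse
metric (so `g = (Matrix.of h)⁻¹`). -/
def sqrtNegDet (h : Fin 2 → Fin 2 → ℝ) : ℝ :=
  Real.sqrt (-((Matrix.of h)⁻¹).det)

/-- The Polyakov Lagrangian
`𝓛(g^{··}, x) = -(T/2) √(-det g) η_{μν} g^{ab} xᵘ_a xᵛ_b`,
regarded as a smooth function of the entries `g^{ab}`. -/
def PolyLagOfInv (D : ℕ) (T : ℝ) (x : Fin D → Fin 2 → ℝ)
    (h : Fin 2 → Fin 2 → ℝ) : ℝ :=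
  -(T/2) * sqrtNegDet h *
    ∑ a, ∑ b, (∑ μ, ∑ ν, mink D μ ν * x μ a * x ν b) * h a b

lemma sqrtNegDet_eq (h : Fin 2 → Fin 2 → ℝ) :
    sqrtNegDet h = Real.sqrt (-(h 0 0 * h 1 1 - h 0 1 * h 1 0)⁻¹) := by
  simp [sqrtNegDet, Matrix.det_nonsing_inv, Matrix.det_fin_two]

lemma sqrtNegDet_inv (g : Fin 2 → Fin 2 → ℝ) (hdet : (Matrix.of g).det < 0) :
    sqrtNegDet (fun i j => (Matrix.of g)⁻¹ i j) = Real.sqrt (-(Matrix.of g).det) := by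
  change Real.sqrt (-((Matrix.of g)⁻¹⁻¹).det) = _
  rw [Matrix.nonsing_inv_nonsing_inv _ (isUnit_iff_ne_zero.mpr hdet.ne)]

lemma hasFDerivAt_entry (h : Fin 2 → Fin 2 → ℝ) (i j : Fin 2) :
    HasFDerivAt (fun k : Fin 2 → Fin 2 → ℝ => k i j)
      ((ContinuousLinearMap.proj (R := ℝ) (φ := fun _ : Fin 2 => ℝ) j).comp
        (ContinuousLinearMap.proj (R := ℝ) (φ := fun _ : Fin 2 => Fin 2 → ℝ) i)) h :=
  ContinuousLinearMap.hasFDerivAt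
    ((ContinuousLinearMap.proj (R := ℝ) (φ := fun _ : Fin 2 => ℝ) j).comp
      (ContinuousLinearMap.proj (R := ℝ) (φ := fun _ : Fin 2 => Fin 2 → ℝ) i))

/-- Jacobi's formula for `√(-det g)` as a function of the inverse of `g`. -/
lemma hasFDerivAt_sqrtNegDet (g : Fin 2 → Fin 2 → ℝ) (hdet : (Matrix.of g).det < 0) :
    HasFDerivAt sqrtNegDet
      (∑ i, ∑ j, (-(1/2) * Real.sqrt (-(Matrix.of g).det) * g j i) •
        (ContinuousLinearMap.proj (R := ℝ) (φ := fun _ : Fin 2 => ℝ) j).comp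
          (ContinuousLinearMap.proj (R := ℝ) (φ := fun _ : Fin 2 => Fin 2 → ℝ) i))
      (fun i j => (Matrix.of g)⁻¹ i j) := by
  set h : Fin 2 → Fin 2 → ℝ := fun i j => (Matrix.of g)⁻¹ i j with hh
  set G : ℝ := (Matrix.of g).det with hG
  have hG0 : G ≠ 0 := hdet.ne
  have e00 : h 0 0 = G⁻¹ * g 1 1 := by
    simp [hh, hG, Matrix.inv_def, Matrix.adjugate_fin_two]
  have e01 : h 0 1 = -(G⁻¹ * g 0 1) := by
    simp [hh, hG, Matrix.inv_def, Matrix.adjugate_fin_two]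
  have e10 : h 1 0 = -(G⁻¹ * g 1 0) := by
    simp [hh, hG, Matrix.inv_def, Matrix.adjugate_fin_two]
  have e11 : h 1 1 = G⁻¹ * g 0 0 := by
    simp [hh, hG, Matrix.inv_def, Matrix.adjugate_fin_two]
  have hGe : G = g 0 0 * g 1 1 - g 0 1 * g 1 0 := by
    simp [hG, Matrix.det_fin_two]
  have hd : h 0 0 * h 1 1 - h 0 1 * h 1 0 = G⁻¹ := by
    rw [e00, e01, e10, e11]
    field_simp
    rw [hGe]
    ring
  have hS : Real.sqrt (-G) ≠ 0 := (Real.sqrt_pos.mpr (by linarith)).ne'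
  have hS2 : Real.sqrt (-G) ^ 2 = -G := Real.sq_sqrt (by linarith)
  have hder := ((hasDerivAt_inv (x := h 0 0 * h 1 1 - h 0 1 * h 1 0)
      (by rw [hd]; exact inv_ne_zero hG0)).comp_hasFDerivAt h
      (((hasFDerivAt_entry h 0 0).mul (hasFDerivAt_entry h 1 1)).sub
        ((hasFDerivAt_entry h 0 1).mul (hasFDerivAt_entry h 1 0)))).neg.sqrt
      (by simp [hd, hG0])
  refine (hder.congr_of_eventuallyEq (Filter.Eventually.of_forall sqrtNegDet_eq)).congr_fderiv ?_
  ext v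
  simp [hd, Fin.sum_univ_two]
  rw [e00, e01, e10, e11]
  field_simp
  rw [hS2]
  ring

/-- Regarding the Polyakov Lagrangian as a function of the
entries `g^{ab}` of the inverse of a symmetric 2×2 matrix `g` with
`det g < 0`, one has
`∂𝓛/∂g^{ab} = -(T/2) √(-det g) (η_{μν} xᵘ_a xᵛ_b - ½ g_{ab} g^{cd} η_{μν} xᵘ_c xᵛ_d)`,
i.e. `-(2/T)(1/√(-det g)) ∂𝓛/∂g^{ab} = T_{ab}` (the Hilbert stress–energy
tensor); equivalently `∂√(-det g)/∂g^{ab} = -½ √(-det g) g_{ab}`. -/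
theorem stmt15 (D : ℕ) (T : ℝ) (hT : 0 < T) (x : Fin D → Fin 2 → ℝ)
    (g : Fin 2 → Fin 2 → ℝ) (hsym : ∀ a b, g a b = g b a)
    (hdet : (Matrix.of g).det < 0) (a b : Fin 2) :
    -- ∂𝓛/∂g^{ab} = -(T/2)√(-det g)(η_{μν}xᵘ_a xᵛ_b - ½ g_{ab} g^{cd} η_{μν} xᵘ_c xᵛ_d)
    (fderiv ℝ (PolyLagOfInv D T x) (fun i j => (Matrix.of g)⁻¹ i j)
        (Pi.single a (Pi.single b 1)) =
      -(T/2) * Real.sqrt (-(Matrix.of g).det) *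
        ((∑ μ, ∑ ν, mink D μ ν * x μ a * x ν b)
          - (1/2) * g a b *
              ∑ c, ∑ d, (Matrix.of g)⁻¹ c d * ∑ μ, ∑ ν, mink D μ ν * x μ c * x ν d)) ∧
    -- i.e. -(2/T)(1/√(-det g)) ∂𝓛/∂g^{ab} = T_{ab}
    (-(2/T) * (1 / Real.sqrt (-(Matrix.of g).det)) *
        fderiv ℝ (PolyLagOfInv D T x) (fun i j => (Matrix.of g)⁻¹ i j)
          (Pi.single a (Pi.single b 1)) =
      ∑ μ, ∑ ν, mink D μ ν *
        (x μ a * x ν b -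
          (1/2) * (∑ c, ∑ d, (Matrix.of g)⁻¹ c d * x μ c * x ν d) * g a b)) ∧
    -- equivalently ∂√(-det g)/∂g^{ab} = -½ √(-det g) g_{ab}
    (fderiv ℝ sqrtNegDet (fun i j => (Matrix.of g)⁻¹ i j)
        (Pi.single a (Pi.single b 1)) =
      -(1/2) * Real.sqrt (-(Matrix.of g).det) * g a b) := by
  have hs := hasFDerivAt_sqrtNegDet g hdet
  have hlin : HasFDerivAt (fun h : Fin 2 → Fin 2 → ℝ =>
      ∑ c, ∑ d, (∑ μ, ∑ ν, mink D μ ν * x μ c * x ν d) * h c d) _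
      (fun i j => (Matrix.of g)⁻¹ i j) :=
    HasFDerivAt.fun_sum fun c _ => HasFDerivAt.fun_sum fun d _ =>
      (hasFDerivAt_entry _ c d).const_mul (∑ μ, ∑ ν, mink D μ ν * x μ c * x ν d)
  have hL : HasFDerivAt (PolyLagOfInv D T x) _ (fun i j => (Matrix.of g)⁻¹ i j) :=
    (hs.const_mul (-(T/2))).mul hlin
  have hS : Real.sqrt (-(Matrix.of g).det) ≠ 0 := (Real.sqrt_pos.mpr (by linarith)).ne'
  have hvar : fderiv ℝ (PolyLagOfInv D T x) (fun i j => (Matrix.of g)⁻¹ i j)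
        (Pi.single a (Pi.single b 1)) =
      -(T/2) * Real.sqrt (-(Matrix.of g).det) *
        ((∑ μ, ∑ ν, mink D μ ν * x μ a * x ν b)
          - (1/2) * g a b *
              ∑ c, ∑ d, (Matrix.of g)⁻¹ c d * ∑ μ, ∑ ν, mink D μ ν * x μ c * x ν d) := by
    rw [hL.fderiv, sqrtNegDet_inv g hdet]
    generalize Real.sqrt (-(Matrix.of g).det) = S
    generalize (Matrix.of g)⁻¹ = k
    have key : ∀ q : Fin 2 → Fin 2 → ℝ,
        ∑ i, ∑ j, q i j * (Pi.single a (Pi.single b 1) : Fin 2 → Fin 2 → ℝ) i j = q a b := by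
      intro q
      fin_cases a <;> fin_cases b <;> simp [Fin.sum_univ_two]
    simp only [add_apply, smul_apply, sum_apply,
      ContinuousLinearMap.comp_apply, ContinuousLinearMap.proj_apply, smul_eq_mul]
    rw [key (fun i j => -(1/2) * S * g j i),
      key (fun i j => ∑ μ, ∑ ν, mink D μ ν * x μ i * x ν j), hsym b a]
    simp only [mul_comm (k _ _)]
    ring
  refine ⟨hvar, ?_, ?_⟩
  · have hcontract : ∑ c, ∑ d, (Matrix.of g)⁻¹ c d * ∑ μ, ∑ ν, mink D μ ν * x μ c * x ν d =
        ∑ μ, ∑ ν, mink D μ ν * ∑ c, ∑ d, (Matrix.of g)⁻¹ c d * x μ c * x ν d := by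
      simp only [Fin.sum_univ_two, Finset.mul_sum, ← Finset.sum_add_distrib]
      refine Finset.sum_congr rfl fun μ _ => Finset.sum_congr rfl fun ν _ => ?_
      ring
    rw [hvar, hcontract]
    have hT0 := hT.ne'
    calc _ = (∑ μ, ∑ ν, mink D μ ν * x μ a * x ν b) - (1/2) * g a b *
          ∑ μ, ∑ ν, mink D μ ν * ∑ c, ∑ d, (Matrix.of g)⁻¹ c d * x μ c * x ν d := by
          field_simp
      _ = _ := by
          rw [Finset.mul_sum, ← Finset.sum_sub_distrib]
          refine Finset.sum_congr rfl fun μ _ => ?_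
          rw [Finset.mul_sum, ← Finset.sum_sub_distrib]
          refine Finset.sum_congr rfl fun ν _ => ?_
          ring
  · rw [hs.fderiv]
    fin_cases a <;> fin_cases b <;> simp [Fin.sum_univ_two, hsym 0 1]
end
end

section
/- The Polyakov Lagrangian is invariant under lifted spacetime Poincaré transformations: let 𝓛 = −(T/2)√(−det g) η_{μν} g^{ab} x^μ_a x^ν_b, let ω^μ_ν be a matrix with η_{μσ}ω^σ_ν antisymmetric, and a^μ ∈ ℝ^D. Then the derivative of 𝓛 along the 1-jet lift X_ζ = (ω^μ_ν x^ν + a^μ) ∂/∂x^μ − x^ν_a ω^μ_ν ∂/∂x^μ_a vanishes identically: since 𝓛 does not depend on x^μ, this reduces to −x^ν_a ω^μ_ν (∂𝓛/∂x^μ_a) = T√(−det g) ω_{ρν} g^{ab} x^ν_a x^ρ_b = 0, which holds by the antisymmetry of ω_{ρν} = η_{ρσ}ω^σ_ν and the symmetry of g^{ab} x^ν_a x^ρ_b in (ν,ρ). -/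
/-!
Invariance of the Polyakov Lagrangian under lifted spacetime Poincaré
transformations.  The relevant coordinates are `(xᵘ, g^{ab}, xᵘ_a)` (the
Lagrangian does not depend on the remaining jet coordinates); `g_{ab}` is the
inverse of the coordinate matrix `(g^{ab})`, with `det g < 0`.
-/

noncomputable section

/-- Coordinates `(xᵘ, g^{ab}, xᵘ_a)` on which the Polyakov Lagrangian lives. -/
abbrev PolyC (D : ℕ) := (Fin D → ℝ) × (Fin 2 → Fin 2 → ℝ) × (Fin D → Fin 2 → ℝ)

/-- The Polyakov Lagrangian `𝓛 = -(T/2)√(-det g) η_{μν} g^{ab} xᵘ_a xᵛ_b`. -/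
def PolyLag (D : ℕ) (T : ℝ) (p : PolyC D) : ℝ :=
  -(T/2) * Real.sqrt (-((Matrix.of p.2.1)⁻¹).det) *
    ∑ a, ∑ b, ∑ μ, ∑ ν, mink D μ ν * p.2.1 a b * p.2.2 μ a * p.2.2 ν b

/-- The 1-jet lift of the infinitesimal Poincaré transformation,
`X_ζ = (ωᵘ_ν xᵛ + aᵘ) ∂/∂xᵘ - xᵛ_a ωᵘ_ν ∂/∂xᵘ_a`, as a tangent vector at
the point `p`. -/
def XPoinc (D : ℕ) (ω : Fin D → Fin D → ℝ) (avec : Fin D → ℝ) (p : PolyC D) :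
    PolyC D :=
  (fun μ => (∑ ν, ω μ ν * p.1 ν) + avec μ, 0,
   fun μ a => -(∑ ν, ω μ ν * p.2.2 ν a))

theorem mink_comm (D : ℕ) (μ ν : Fin D) : mink D μ ν = mink D ν μ := by
  unfold mink
  by_cases h : μ = ν
  · rw [h]
  · rw [if_neg h, if_neg (Ne.symm h)]

/-- An infinitesimal Lorentz transformation is skew-adjoint for the Minkowski metric. -/
theorem mink_skew (D : ℕ) (ω : Fin D → Fin D → ℝ)
    (hanti : ∀ μ ν, (∑ σ, mink D μ σ * ω σ ν) = -∑ σ, mink D ν σ * ω σ μ)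
    (u w : Fin D → ℝ) :
    (∑ μ, ∑ ν, mink D μ ν * (∑ σ, ω μ σ * u σ) * w ν) +
      ∑ μ, ∑ ν, mink D μ ν * u μ * (∑ σ, ω ν σ * w σ) = 0 := by
  have h₁ : (∑ μ, ∑ ν, mink D μ ν * (∑ σ, ω μ σ * u σ) * w ν) =
      ∑ μ, ∑ ν, (∑ σ, mink D ν σ * ω σ μ) * (u μ * w ν) := by
    calc _ = ∑ ν, ∑ μ, ∑ σ, mink D ν μ * ω μ σ * (u σ * w ν) := by
          rw [Finset.sum_comm]
          refine Finset.sum_congr rfl fun ν _ => Finset.sum_congr rfl fun μ _ => ?_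
          rw [Finset.mul_sum, Finset.sum_mul]
          refine Finset.sum_congr rfl fun σ _ => ?_
          rw [mink_comm D μ ν]
          ring
      _ = _ := by
          rw [Finset.sum_comm (f := fun μ ν => (∑ σ, mink D ν σ * ω σ μ) * (u μ * w ν))]
          refine Finset.sum_congr rfl fun ν _ => ?_
          rw [Finset.sum_comm]
          exact Finset.sum_congr rfl fun σ _ => (Finset.sum_mul ..).symm
  have h₂ : (∑ μ, ∑ ν, mink D μ ν * u μ * (∑ σ, ω ν σ * w σ)) =
      ∑ μ, ∑ ν, (∑ σ, mink D μ σ * ω σ ν) * (u μ * w ν) := by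
    refine Finset.sum_congr rfl fun μ _ => ?_
    simp only [Finset.mul_sum, Finset.sum_mul]
    rw [Finset.sum_comm]
    exact Finset.sum_congr rfl fun ν _ => Finset.sum_congr rfl fun σ _ => by ring
  rw [h₁, h₂, ← Finset.sum_add_distrib]
  refine Finset.sum_eq_zero fun μ _ => ?_
  rw [← Finset.sum_add_distrib]
  refine Finset.sum_eq_zero fun ν _ => ?_
  rw [hanti μ ν]
  ring

/-- Along the straight line in the direction of the lift, the Polyakov Lagrangian has no
first-order term. -/
theorem polyLag_add_smul_XPoinc (D : ℕ) (T : ℝ) (ω : Fin D → Fin D → ℝ) (avec : Fin D → ℝ)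
    (hanti : ∀ μ ν, (∑ σ, mink D μ σ * ω σ ν) = -∑ σ, mink D ν σ * ω σ μ)
    (p : PolyC D) (t : ℝ) :
    PolyLag D T (p + t • XPoinc D ω avec p) =
      PolyLag D T p + t ^ 2 * PolyLag D T (p.1, p.2.1, (XPoinc D ω avec p).2.2) := by
  have hg : (p + t • XPoinc D ω avec p).2.1 = p.2.1 := by simp [XPoinc]
  have hx : ∀ μ a, (p + t • XPoinc D ω avec p).2.2 μ a =
      p.2.2 μ a - t * ∑ ν, ω μ ν * p.2.2 ν a := by
    intro μ a
    simp [XPoinc, sub_eq_add_neg]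
  unfold PolyLag
  rw [hg, mul_left_comm, ← mul_add]
  congr 1
  simp only [hx, Finset.mul_sum _ _ (t ^ 2), ← Finset.sum_add_distrib]
  refine Finset.sum_congr rfl fun a _ => Finset.sum_congr rfl fun b _ => ?_
  have h := mink_skew D ω hanti (fun μ => p.2.2 μ a) (fun μ => p.2.2 μ b)
  rw [← sub_eq_zero, ← mul_zero (-(t * p.2.1 a b)), ← h]
  simp only [← Finset.sum_add_distrib, ← Finset.sum_sub_distrib]
  rw [Finset.mul_sum _ _ (-(t * p.2.1 a b))]
  refine Finset.sum_congr rfl fun μ _ => ?_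
  rw [Finset.mul_sum _ _ (-(t * p.2.1 a b))]
  refine Finset.sum_congr rfl fun ν _ => ?_
  simp only [XPoinc]
  ring

/-- The Polyakov Lagrangian is invariant under lifted
spacetime Poincaré transformations: if `η_{μσ}ω^σ_ν` is antisymmetric and
`aᵘ ∈ ℝᴰ`, then the derivative of `𝓛` along the 1-jet lift
`X_ζ = (ωᵘ_ν xᵛ + aᵘ)∂/∂xᵘ - xᵛ_a ωᵘ_ν ∂/∂xᵘ_a` vanishes identically. -/
theorem stmt16 (D : ℕ) (T : ℝ) (hT : 0 < T)
    (ω : Fin D → Fin D → ℝ) (avec : Fin D → ℝ)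
    (hanti : ∀ μ ν, (∑ σ, mink D μ σ * ω σ ν) = -∑ σ, mink D ν σ * ω σ μ)
    (p : PolyC D) (hdet : ((Matrix.of p.2.1)⁻¹).det < 0) :
    fderiv ℝ (PolyLag D T) p (XPoinc D ω avec p) = 0 := by
  by_cases hd : DifferentiableAt ℝ (PolyLag D T) p
  · rw [← hd.lineDeriv_eq_fderiv, lineDeriv]
    simp only [polyLag_add_smul_XPoinc D T ω avec hanti p]
    simp
  · rw [fderiv_zero_of_not_differentiableAt hd, zero_apply]
end
end

section
/- For the Polyakov string, the contraction of the canonical lift of the Weyl vector field with the Poincaré–Cartan m-form vanishes identically: with Θ_L = −(T/2)√(−det g) η_{μν} g^{ab} x^ν_b dx^μ ∧ d¹σ_a + (T/2)√(−det g) η_{μν} g^{ab} x^μ_a x^ν_b d²σ and X_φ = e^{−φ} g^{ab} ∂/∂g^{ab} + e^{−φ}(g^{ab}_c − g^{ab}∂_cφ) ∂/∂g^{ab}_c, one has i(X_φ)Θ_L = 0; consequently the multimomentum map associated with Weyl transformations is zero. -/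
/-!
The Polyakov jet bundle has coordinates `(σᵃ, xᵘ, g^{ab}, xᵘ_a, g^{ab}_c)`
(worldsheet indices `a,b,c ∈ Fin 2`, spacetime indices `μ,ν ∈ Fin D`).  Here
`d²σ = dσ⁰ ∧ dσ¹`, `d¹σ_a = i(∂/∂σᵃ)d²σ`, and
`dxᵘ ∧ d¹σ_a = -i(∂/∂σᵃ)(dxᵘ ∧ d²σ)`.  Forms are represented by their
pointwise evaluation functions.
-/

noncomputable section

/-- The Polyakov jet bundle, with coordinates
`(σᵃ, xᵘ, g^{ab}, xᵘ_a, g^{ab}_c)` (the last component is `a b c ↦ g^{ab}_c`). -/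
abbrev PolyJ (D : ℕ) :=
  (Fin 2 → ℝ) × (Fin D → ℝ) × (Fin 2 → Fin 2 → ℝ) × (Fin D → Fin 2 → ℝ) ×
    (Fin 2 → Fin 2 → Fin 2 → ℝ)

def dsig (D : ℕ) (a : Fin 2) : PolyJ D → ℝ := fun v => v.1 a
def dxP (D : ℕ) (μ : Fin D) : PolyJ D → ℝ := fun v => v.2.1 μ
/-- The coordinate vector `∂/∂σᵃ`. -/
def esig (D : ℕ) (a : Fin 2) : PolyJ D := (Pi.single a 1, 0, 0, 0, 0)

/-- The Poincaré–Cartan 2-form of the Polyakov Lagrangian: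
`Θ_L = -(T/2)√(-det g) η_{μν} g^{ab} xᵛ_b dxᵘ ∧ d¹σ_a
       + (T/2)√(-det g) η_{μν} g^{ab} xᵘ_a xᵛ_b d²σ`. -/
def ThetaPoly (D : ℕ) (T : ℝ) (p : PolyJ D) (v : Fin 2 → PolyJ D) : ℝ :=
  (∑ μ, ∑ ν, ∑ a, ∑ b,
      -(T/2) * Real.sqrt (-((Matrix.of p.2.2.1)⁻¹).det) *
        mink D μ ν * p.2.2.1 a b * p.2.2.2.1 ν b *
        (-(wedgeEval ![dxP D μ, dsig D 0, dsig D 1] (Fin.cons (esig D a) v))))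
  + (T/2) * Real.sqrt (-((Matrix.of p.2.2.1)⁻¹).det) *
      (∑ μ, ∑ ν, ∑ a, ∑ b,
        mink D μ ν * p.2.2.1 a b * p.2.2.2.1 μ a * p.2.2.2.1 ν b) *
      wedgeEval ![dsig D 0, dsig D 1] v

/-- The canonical (1-jet) lift of the Weyl vector field
`φ_E = e^{-φ} g^{ab} ∂/∂g^{ab}`:
`X_φ = e^{-φ} g^{ab} ∂/∂g^{ab} + e^{-φ}(g^{ab}_c - g^{ab}∂_cφ) ∂/∂g^{ab}_c`. -/
def XWeyl (D : ℕ) (φ : (Fin 2 → ℝ) → ℝ) (p : PolyJ D) : PolyJ D :=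
  (0, 0,
   fun a b => Real.exp (-(φ p.1)) * p.2.2.1 a b,
   0,
   fun a b c => Real.exp (-(φ p.1)) *
     (p.2.2.2.2 a b c - p.2.2.1 a b * fderiv ℝ φ p.1 (Pi.single c 1)))

/-- A wedge product of covectors vanishes as soon as all of them kill one of the arguments. -/
theorem wedgeEval_eq_zero {V : Type*} {j : ℕ} {ℓ : Fin j → V → ℝ} {v : Fin j → V} (i : Fin j)
    (h : ∀ s, ℓ s (v i) = 0) : wedgeEval ℓ v = 0 :=
  Matrix.det_eq_zero_of_row_eq_zero i h

/-- The Poincaré–Cartan form is semibasic over the `(σ, x)`-coordinates: it vanishes when its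
first argument has no `σ`- and no `x`-component. -/
theorem ThetaPoly_eq_zero_of_vertical (D : ℕ) (T : ℝ) (p u w : PolyJ D)
    (hσ : u.1 = 0) (hx : u.2.1 = 0) : ThetaPoly D T p ![u, w] = 0 := by
  have hdsig : ∀ a, dsig D a u = 0 := fun a => congrFun hσ a
  have hdx : ∀ μ, dxP D μ u = 0 := fun μ => congrFun hx μ
  have h₂ : wedgeEval ![dsig D 0, dsig D 1] ![u, w] = 0 :=
    wedgeEval_eq_zero 0 (Fin.forall_fin_two.2 ⟨hdsig 0, hdsig 1⟩)
  have h₃ : ∀ μ a, wedgeEval ![dxP D μ, dsig D 0, dsig D 1]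
      (Fin.cons (esig D a) ![u, w]) = 0 := fun μ a =>
    wedgeEval_eq_zero 1 (by
      intro s
      fin_cases s
      exacts [hdx μ, hdsig 0, hdsig 1])
  simp only [ThetaPoly, h₂, h₃, neg_zero, mul_zero, Finset.sum_const_zero, add_zero]

/-- For the Polyakov string, the contraction of the
canonical lift of the Weyl vector field with the Poincaré–Cartan form
vanishes identically: `i(X_φ)Θ_L = 0`; consequently the multimomentum map
associated with Weyl transformations, `J_L(X_φ) = -i(X_φ)Θ_L`, is zero. -/
theorem stmt17 (D : ℕ) (T : ℝ) (hT : 0 < T)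
    (φ : (Fin 2 → ℝ) → ℝ) (hφ : ContDiff ℝ (⊤:ℕ∞) φ) :
    (∀ (p : PolyJ D) (w : PolyJ D), ThetaPoly D T p ![XWeyl D φ p, w] = 0) ∧
    (∀ (p : PolyJ D) (w : PolyJ D), -ThetaPoly D T p ![XWeyl D φ p, w] = 0) := by
  have h : ∀ p w : PolyJ D, ThetaPoly D T p ![XWeyl D φ p, w] = 0 := fun p w =>
    ThetaPoly_eq_zero_of_vertical D T p _ w rfl rfl
  exact ⟨h, fun p w => neg_eq_zero.2 (h p w)⟩
end
end

section
/- The Hamiltonian Virasoro constraint of the Polyakov string is the Legendre-transform image of the Lagrangian one: substituting the Legendre map p^a_μ = −T√(−det g) η_{μν} g^{ab} x^ν_b into the Hamiltonian constraint expression η^{μν}(p^a_μ p^b_ν − ½ g_{cd} g^{ba} p^d_μ p^c_ν) yields T²(−det g) g^{ac} g^{bd} T_{cd}, where T_{cd} = η_{μν}(x^μ_c x^ν_d − ½ g^{ef} g_{cd} x^μ_e x^ν_f) is the Lagrangian Virasoro (stress–energy) constraint. In particular, since g is invertible and T√(−det g) ≠ 0, the Hamiltonian constraint vanishes if and only if T_{cd}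 = 0. -/
/-!
The Hamiltonian Virasoro constraint of the Polyakov string is the
Legendre-transform image of the Lagrangian one.  Worldsheet indices
`a,b,c,d,e,f` run over `Fin 2`, spacetime indices `μ,ν` over `Fin D`;
summation over repeated indices is written explicitly.  `(g_{ab})` is an
invertible symmetric 2×2 matrix with `det g < 0` and inverse `(g^{ab})`;
for the diagonal Minkowski metric, `η^{μν}` agrees with `η_{μν}`.
-/

noncomputable section

/-- The diagonal entries of the Minkowski metric. -/
def minkSign {D : ℕ} (μ : Fin D) : ℝ := if (μ : ℕ) = 0 then -1 else 1

lemma minkSign_mul_self {D : ℕ} (μ : Fin D) : minkSign μ * minkSign μ = 1 := by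
  unfold minkSign
  split_ifs <;> norm_num

lemma sum_mink_mul {D : ℕ} (μ : Fin D) (f : Fin D → ℝ) :
    ∑ ν, mink D μ ν * f ν = minkSign μ * f μ := by
  simp [mink, minkSign]

/-- A left inverse of a symmetric matrix is symmetric. -/
lemma leftInverse_symm {g ginv : Fin 2 → Fin 2 → ℝ} (hsym : ∀ a b, g a b = g b a)
    (hinv : ∀ a c, (∑ b, ginv a b * g b c) = if a = c then (1 : ℝ) else 0) (a b : Fin 2) :
    ginv a b = ginv b a := by
  have h : Matrix.of ginv * Matrix.of g = 1 := by
    ext a c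
    simpa [Matrix.mul_apply, Matrix.one_apply] using hinv a c
  have hg : (Matrix.of g).transpose = Matrix.of g := by
    ext a c
    exact hsym c a
  have ht : (Matrix.of ginv).transpose = Matrix.of ginv := by
    rw [← Matrix.inv_eq_left_inv h, Matrix.transpose_nonsing_inv, hg]
  exact congrFun (congrFun ht b) a

/-- Raising both indices of the metric gives the inverse metric. -/
lemma raise_metric {g ginv : Fin 2 → Fin 2 → ℝ} (hsym : ∀ a b, g a b = g b a)
    (hinv : ∀ a c, (∑ b, ginv a b * g b c) = if a = c then (1 : ℝ) else 0) (a b : Fin 2) :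
    ∑ c, ∑ d, ginv a c * ginv b d * g c d = ginv b a := by
  calc ∑ c, ∑ d, ginv a c * ginv b d * g c d
      = ∑ c, ginv a c * ∑ d, ginv b d * g d c := by
        refine Finset.sum_congr rfl fun c _ => ?_
        rw [Finset.mul_sum]
        refine Finset.sum_congr rfl fun d _ => ?_
        rw [hsym c d]
        ring
    _ = ginv b a := by
        simp only [hinv]
        simp [leftInverse_symm hsym hinv a b]

/-- The metric square of a raised vector is the inverse-metric square of the vector. -/
lemma metric_raise {g ginv : Fin 2 → Fin 2 → ℝ}
    (hinv' : ∀ a c, (∑ b, g a b * ginv b c) = if a = c then (1 : ℝ) else 0)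
    (u : Fin 2 → ℝ) :
    ∑ c, ∑ d, g c d * (∑ e, ginv d e * u e) * (∑ f, ginv c f * u f) =
      ∑ e, ∑ f, ginv e f * u e * u f := by
  have h : ∀ c, ∑ d, g c d * (∑ e, ginv d e * u e) = u c := by
    intro c
    calc ∑ d, g c d * (∑ e, ginv d e * u e) = ∑ e, (∑ d, g c d * ginv d e) * u e := by
          simp only [Fin.sum_univ_two]
          ring
      _ = u c := by
          simp only [hinv']
          simp
  refine Finset.sum_congr rfl fun c _ => ?_
  rw [← Finset.sum_mul, h, Finset.mul_sum]
  exact Finset.sum_congr rfl fun f _ => by ring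

/-- A tensor vanishes if it vanishes after raising both indices. -/
lemma eq_zero_of_raise_eq_zero {g ginv : Fin 2 → Fin 2 → ℝ}
    (hinv' : ∀ a c, (∑ b, g a b * ginv b c) = if a = c then (1 : ℝ) else 0)
    (t : Fin 2 → Fin 2 → ℝ) (ht : ∀ a b, ∑ c, ∑ d, ginv a c * ginv b d * t c d = 0)
    (c d : Fin 2) : t c d = 0 := by
  have h : ∑ a, ∑ b, g c a * g d b * (∑ c', ∑ d', ginv a c' * ginv b d' * t c' d') =
      ∑ c', ∑ d', (∑ a, g c a * ginv a c') * (∑ b, g d b * ginv b d') * t c' d' := by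
    simp only [Fin.sum_univ_two]
    ring
  simp only [ht, hinv'] at h
  simpa using h.symm

/-- Substituting the Legendre map
`pᵃ_μ = -T√(-det g) η_{μν} g^{ab} xᵛ_b` into the Hamiltonian constraint
expression `ηᵘᵛ(pᵃ_μ pᵇ_ν - ½ g_{cd} g^{ba} pᵈ_μ pᶜ_ν)` yields
`T²(-det g) g^{ac} g^{bd} T_{cd}`, where
`T_{cd} = η_{μν}(xᵘ_c xᵛ_d - ½ g^{ef} g_{cd} xᵘ_e xᵛ_f)` is the Lagrangian
Virasoro (stress–energy) constraint.  In particular, since `g` is invertible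
and `T√(-det g) ≠ 0`, the Hamiltonian constraint vanishes if and only if
`T_{cd} = 0`. -/
theorem stmt18 (D : ℕ) (T : ℝ) (hT : 0 < T)
    (g ginv : Fin 2 → Fin 2 → ℝ)
    (hsym : ∀ a b, g a b = g b a)
    (hinv : ∀ a c, (∑ b, ginv a b * g b c) = if a = c then (1:ℝ) else 0)
    (hinv' : ∀ a c, (∑ b, g a b * ginv b c) = if a = c then (1:ℝ) else 0)
    (hdet : (Matrix.of g).det < 0)
    (x : Fin D → Fin 2 → ℝ) (p : Fin 2 → Fin D → ℝ)
    -- the Legendre map of the Polyakov Lagrangian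
    (hp : ∀ a μ, p a μ =
      -T * Real.sqrt (-(Matrix.of g).det) * ∑ ν, ∑ b, mink D μ ν * ginv a b * x ν b) :
    -- the Hamiltonian constraint is the Legendre image of the Lagrangian one …
    (∀ a b, (∑ μ, ∑ ν, mink D μ ν *
        (p a μ * p b ν - (1/2) * ∑ c, ∑ d, g c d * ginv b a * p d μ * p c ν)) =
      T^2 * (-(Matrix.of g).det) *
        ∑ c, ∑ d, ginv a c * ginv b d *
          (∑ μ, ∑ ν, mink D μ ν *
            (x μ c * x ν d - (1/2) * (∑ e, ∑ f, ginv e f * x μ e * x ν f) * g c d))) ∧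
    -- … and in particular it vanishes iff T_{cd} = 0
    ((∀ a b, (∑ μ, ∑ ν, mink D μ ν *
        (p a μ * p b ν - (1/2) * ∑ c, ∑ d, g c d * ginv b a * p d μ * p c ν)) = 0) ↔
      (∀ c d, (∑ μ, ∑ ν, mink D μ ν *
        (x μ c * x ν d - (1/2) * (∑ e, ∑ f, ginv e f * x μ e * x ν f) * g c d)) = 0)) := by
  have main : ∀ a b, (∑ μ, ∑ ν, mink D μ ν *
        (p a μ * p b ν - (1/2) * ∑ c, ∑ d, g c d * ginv b a * p d μ * p c ν)) =
      T^2 * (-(Matrix.of g).det) *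
        ∑ c, ∑ d, ginv a c * ginv b d *
          (∑ μ, ∑ ν, mink D μ ν *
            (x μ c * x ν d - (1/2) * (∑ e, ∑ f, ginv e f * x μ e * x ν f) * g c d)) := by
    intro a b
    have hk : Real.sqrt (-(Matrix.of g).det) ^ 2 = -(Matrix.of g).det :=
      Real.sq_sqrt (by linarith)
    rw [← hk]
    set k := Real.sqrt (-(Matrix.of g).det)
    have hp' : ∀ a μ, p a μ = -T * k * minkSign μ * ∑ e, ginv a e * x μ e := by
      intro a μ
      rw [hp, mul_assoc (-T * k), ← sum_mink_mul μ fun ν => ∑ e, ginv a e * x ν e]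
      simp only [Finset.mul_sum, mul_assoc]
    simp only [sum_mink_mul]
    have hswap : ∀ F : Fin D → Fin 2 → Fin 2 → ℝ,
        ∑ c, ∑ d, ginv a c * ginv b d * ∑ μ, F μ c d =
          ∑ μ, ∑ c, ∑ d, ginv a c * ginv b d * F μ c d := by
      intro F
      simp only [Finset.mul_sum, Fin.sum_univ_two, Finset.sum_add_distrib]
    rw [hswap fun μ c d => minkSign μ *
      (x μ c * x μ d - (1/2) * (∑ e, ∑ f, ginv e f * x μ e * x μ f) * g c d), Finset.mul_sum]
    refine Finset.sum_congr rfl fun μ _ => ?_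
    have hq := metric_raise hinv' (x μ)
    have hr := raise_metric hsym hinv a b
    have hs := minkSign_mul_self μ
    set q := ∑ e, ∑ f, ginv e f * x μ e * x μ f
    have hleft : ∑ c, ∑ d, g c d * ginv b a * p d μ * p c μ = T ^ 2 * k ^ 2 * ginv b a * q := by
      calc ∑ c, ∑ d, g c d * ginv b a * p d μ * p c μ
          = T ^ 2 * k ^ 2 * (minkSign μ * minkSign μ) * ginv b a *
              ∑ c, ∑ d, g c d * (∑ e, ginv d e * x μ e) * (∑ f, ginv c f * x μ f) := by
            simp only [hp', Fin.sum_univ_two]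
            ring
        _ = T ^ 2 * k ^ 2 * ginv b a * q := by rw [hq, hs, mul_one]
    have hright : ∑ c, ∑ d, ginv a c * ginv b d *
          (minkSign μ * (x μ c * x μ d - (1/2) * q * g c d)) =
        minkSign μ * ((∑ e, ginv a e * x μ e) * (∑ e, ginv b e * x μ e) -
          (1/2) * q * ginv b a) := by
      rw [← hr]
      simp only [Fin.sum_univ_two]
      ring
    rw [hleft, hright, hp', hp']
    linear_combination minkSign μ * T ^ 2 * k ^ 2 * (∑ e, ginv a e * x μ e) *
      (∑ e, ginv b e * x μ e) * hs
  refine ⟨main, fun h => ?_, fun h a b => ?_⟩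
  · refine eq_zero_of_raise_eq_zero hinv' _ fun a b => ?_
    have hne : T ^ 2 * (-(Matrix.of g).det) ≠ 0 :=
      mul_ne_zero (pow_ne_zero 2 hT.ne') (neg_ne_zero.mpr hdet.ne)
    exact (mul_eq_zero.mp ((main a b).symm.trans (h a b))).resolve_left hne
  · rw [main]
    simp only [h, mul_zero, Finset.sum_const_zero]
end
end

section
/- For the Polyakov string, the 1-jet lift of the worldsheet-diffeomorphism generator is Legendre-projectable onto the canonical Hamiltonian lift: with X_ξ = −ξ^a ∂/∂σ^a − (g^{ac}∂_cξ^b + g^{cb}∂_cξ^a) ∂/∂g^{ab} + x^μ_b ∂_aξ^b ∂/∂x^μ_a − (g^{ac}_d ∂_cξ^b + g^{cb}_d ∂_cξ^a) ∂/∂g^{ab}_d on J¹π and Y°_ξ = −ξ^a ∂/∂σ^a − (g^{ac}∂_cξ^b + g^{cb}∂_cξ^a) ∂/∂g^{ab} + (p^a_μ ∂_bξ^b − p^b_μ ∂_bξ^a) ∂/∂p^a_μ on P₀, one has (FL₀)_* X_ξ = Y°_ξ, where FL₀ is the restricted Legendre map given by p^a_μ = −T√(−det g) η_{μν} g^{ab}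 x^ν_b. -/
/-!
The Polyakov jet bundle `J¹π` has coordinates `(σᵃ, xᵘ, g^{ab}, xᵘ_a, g^{ab}_c)`
and the primary Hamiltonian constraint submanifold `P₀ ⊂ J¹π*` has coordinates
`(σᵃ, xᵘ, g^{ab}, pᵃ_μ)` (worldsheet indices `a,b,c ∈ Fin 2`, spacetime
indices `μ,ν ∈ Fin D`).  `g_{ab}` denotes the inverse of the coordinate
matrix `(g^{ab})`, and `∂_c ξᵇ` the partial derivatives of the worldsheet
vector field components.
-/

noncomputable section

/-- The primary Hamiltonian constraint submanifold `P₀`, coordinates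
`(σᵃ, xᵘ, g^{ab}, pᵃ_μ)`. -/
abbrev PolyP0 (D : ℕ) :=
  (Fin 2 → ℝ) × (Fin D → ℝ) × (Fin 2 → Fin 2 → ℝ) × (Fin 2 → Fin D → ℝ)

/-- The restricted Legendre map `FL₀ : J¹π → P₀`: the identity on
`(σᵃ, xᵘ, g^{ab})`, sending the multivelocities to
`pᵃ_μ = -T√(-det g) η_{μν} g^{ab} xᵛ_b` (and forgetting `g^{ab}_c`). -/
def FL0 (D : ℕ) (T : ℝ) (q : PolyJ D) : PolyP0 D :=
  (q.1, q.2.1, q.2.2.1,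
   fun a μ => -T * Real.sqrt (-((Matrix.of q.2.2.1)⁻¹).det) *
     ∑ ν, ∑ b, mink D μ ν * q.2.2.1 a b * q.2.2.2.1 ν b)

/-- `∂_c ξᵇ` evaluated at `σ`. -/
def dxi (ξ : Fin 2 → (Fin 2 → ℝ) → ℝ) (b c : Fin 2) (σ : Fin 2 → ℝ) : ℝ :=
  fderiv ℝ (ξ b) σ (Pi.single c 1)

/-- The 1-jet canonical lift of the worldsheet-diffeomorphism generator
`ξ = -ξᵃ ∂/∂σᵃ`:
`X_ξ = -ξᵃ ∂/∂σᵃ - (g^{ac}∂_cξᵇ + g^{cb}∂_cξᵃ) ∂/∂g^{ab}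
       + xᵘ_b ∂_aξᵇ ∂/∂xᵘ_a - (g^{ac}_d ∂_cξᵇ + g^{cb}_d ∂_cξᵃ) ∂/∂g^{ab}_d`. -/
def Xws (D : ℕ) (ξ : Fin 2 → (Fin 2 → ℝ) → ℝ) (q : PolyJ D) : PolyJ D :=
  (fun a => -ξ a q.1,
   0,
   fun a b => -((∑ c, q.2.2.1 a c * dxi ξ b c q.1) +
                 ∑ c, q.2.2.1 c b * dxi ξ a c q.1),
   fun μ a => ∑ b, q.2.2.2.1 μ b * dxi ξ b a q.1,
   fun a b d => -((∑ c, q.2.2.2.2 a c d * dxi ξ b c q.1) +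
                   ∑ c, q.2.2.2.2 c b d * dxi ξ a c q.1))

/-- The canonical lift of `ξ` to `P₀`:
`Y°_ξ = -ξᵃ ∂/∂σᵃ - (g^{ac}∂_cξᵇ + g^{cb}∂_cξᵃ) ∂/∂g^{ab}
        + (pᵃ_μ ∂_bξᵇ - pᵇ_μ ∂_bξᵃ) ∂/∂pᵃ_μ`. -/
def Yws (D : ℕ) (ξ : Fin 2 → (Fin 2 → ℝ) → ℝ) (r : PolyP0 D) : PolyP0 D :=
  (fun a => -ξ a r.1,
   0,
   fun a b => -((∑ c, r.2.2.1 a c * dxi ξ b c r.1) +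
                 ∑ c, r.2.2.1 c b * dxi ξ a c r.1),
   fun a μ => (r.2.2.2 a μ * ∑ b, dxi ξ b b r.1) -
                ∑ b, r.2.2.2 b μ * dxi ξ a b r.1)

/-- The factor `√(-det g)`, as a function of the inverse metric `(g^{ab})`. -/
theorem sqrt_neg_det_inv (G : Fin 2 → Fin 2 → ℝ) :
    Real.sqrt (-((Matrix.of G)⁻¹).det) =
      Real.sqrt (-(G 0 0 * G 1 1 - G 0 1 * G 1 0)⁻¹) := by
  rw [Matrix.det_nonsing_inv, Ring.inverse_eq_inv', Matrix.det_fin_two]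
  rfl

theorem det_neg_of_det_inv_neg (G : Fin 2 → Fin 2 → ℝ) (h : ((Matrix.of G)⁻¹).det < 0) :
    G 0 0 * G 1 1 - G 0 1 * G 1 0 < 0 := by
  rw [Matrix.det_nonsing_inv, Ring.inverse_eq_inv', Matrix.det_fin_two, inv_lt_zero] at h
  exact h

/-- If `d < 0` has derivative `-2 τ d`, then `√(-1/d)` has derivative `τ √(-1/d)`. -/
theorem HasDerivAt.sqrt_neg_inv {d : ℝ → ℝ} {t τ : ℝ}
    (h : HasDerivAt d (-2 * τ * d t) t) (hd : d t < 0) :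
    HasDerivAt (fun s => Real.sqrt (-(d s)⁻¹)) (τ * Real.sqrt (-(d t)⁻¹)) t := by
  have hpos : 0 < -(d t)⁻¹ := neg_pos.2 (inv_lt_zero.2 hd)
  refine ((h.fun_inv hd.ne).fun_neg.sqrt hpos.ne').congr_deriv ?_
  have hs : Real.sqrt (-(d t)⁻¹) ≠ 0 := (Real.sqrt_pos.2 hpos).ne'
  rw [div_eq_iff (mul_ne_zero two_ne_zero hs)]
  have hsq := Real.mul_self_sqrt hpos.le
  have hne := hd.ne
  rw [show τ * √(-(d t)⁻¹) * (2 * √(-(d t)⁻¹)) =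
    2 * τ * (√(-(d t)⁻¹) * √(-(d t)⁻¹)) by ring, hsq]
  field_simp

/-- `√(-det g)` along the flow of a linear vector field `A` on the worldsheet. -/
theorem hasDerivAt_sqrt_neg_det_inv (G A : Fin 2 → Fin 2 → ℝ)
    (hG : ((Matrix.of G)⁻¹).det < 0) :
    HasDerivAt
      (fun t : ℝ => Real.sqrt (-((Matrix.of
        (G + t • fun a b => -((∑ c, G a c * A b c) + ∑ c, G c b * A a c)))⁻¹).det))
      ((∑ b, A b b) * Real.sqrt (-((Matrix.of G)⁻¹).det)) 0 := by
  simp only [sqrt_neg_det_inv]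
  set V : Fin 2 → Fin 2 → ℝ :=
    fun a b => -((∑ c, G a c * A b c) + ∑ c, G c b * A a c) with hV
  have hc (a b : Fin 2) : HasDerivAt (fun t : ℝ => (G + t • V) a b) (V a b) 0 := by
    simpa using ((hasDerivAt_id (0 : ℝ)).mul_const (V a b)).const_add (G a b)
  have hdet : HasDerivAt
      (fun t : ℝ => (G + t • V) 0 0 * (G + t • V) 1 1 - (G + t • V) 0 1 * (G + t • V) 1 0)
      (-2 * (∑ b, A b b) * ((G + (0 : ℝ) • V) 0 0 * (G + (0 : ℝ) • V) 1 1 -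
        (G + (0 : ℝ) • V) 0 1 * (G + (0 : ℝ) • V) 1 0)) 0 := by
    refine (((hc 0 0).mul (hc 1 1)).sub ((hc 0 1).mul (hc 1 0))).congr_deriv ?_
    simp only [hV, zero_smul, add_zero, Fin.sum_univ_two]
    ring
  simpa using hdet.sqrt_neg_inv (by simpa using det_neg_of_det_inv_neg G hG)

theorem differentiableAt_FL0 (D : ℕ) (T : ℝ) (q : PolyJ D)
    (hdet : ((Matrix.of q.2.2.1)⁻¹).det < 0) : DifferentiableAt ℝ (FL0 D T) q := by
  have hd := (det_neg_of_det_inv_neg _ hdet).ne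
  have hs : -(q.2.2.1 0 0 * q.2.2.1 1 1 - q.2.2.1 0 1 * q.2.2.1 1 0)⁻¹ ≠ 0 :=
    neg_ne_zero.2 (inv_ne_zero hd)
  unfold FL0
  simp only [sqrt_neg_det_inv]
  fun_prop (disch := assumption)

/-- The momenta transform as a vector density along the lifted flow. -/
theorem hasDerivAt_momentum (D : ℕ) (T : ℝ) (G A : Fin 2 → Fin 2 → ℝ) (v : Fin D → Fin 2 → ℝ)
    (hG : ((Matrix.of G)⁻¹).det < 0) (a : Fin 2) (μ : Fin D) :
    HasDerivAt
      (fun t : ℝ =>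
        -T * Real.sqrt (-((Matrix.of
          (G + t • fun a b => -((∑ c, G a c * A b c) + ∑ c, G c b * A a c)))⁻¹).det) *
        ∑ ν, ∑ b, mink D μ ν *
          (G + t • fun a b => -((∑ c, G a c * A b c) + ∑ c, G c b * A a c)) a b *
          (v + t • fun μ a => ∑ b, v μ b * A b a) ν b)
      ((-T * Real.sqrt (-((Matrix.of G)⁻¹).det) *
          ∑ ν, ∑ b, mink D μ ν * G a b * v ν b) * ∑ b, A b b -
        ∑ b, (-T * Real.sqrt (-((Matrix.of G)⁻¹).det) *
          ∑ ν, ∑ c, mink D μ ν * G b c * v ν c) * A a b) 0 := by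
  have hS := hasDerivAt_sqrt_neg_det_inv G A hG
  set V : Fin 2 → Fin 2 → ℝ :=
    fun a b => -((∑ c, G a c * A b c) + ∑ c, G c b * A a c) with hV
  set W : Fin D → Fin 2 → ℝ := fun μ a => ∑ b, v μ b * A b a with hW
  have hc (b : Fin 2) : HasDerivAt (fun t : ℝ => (G + t • V) a b) (V a b) 0 := by
    simpa using ((hasDerivAt_id (0 : ℝ)).mul_const (V a b)).const_add (G a b)
  have hv (ν : Fin D) (b : Fin 2) : HasDerivAt (fun t : ℝ => (v + t • W) ν b) (W ν b) 0 := by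
    simpa using ((hasDerivAt_id (0 : ℝ)).mul_const (W ν b)).const_add (v ν b)
  have hsum := HasDerivAt.fun_sum (u := Finset.univ) fun ν _ =>
    HasDerivAt.fun_sum (u := Finset.univ) fun b _ =>
      ((hc b).const_mul (mink D μ ν)).fun_mul (hv ν b)
  refine ((hS.const_mul (-T)).mul hsum).congr_deriv ?_
  have hcontr : (∑ ν, ∑ b, (mink D μ ν * V a b * v ν b + mink D μ ν * G a b * W ν b)) =
      -∑ b, (∑ ν, ∑ c, mink D μ ν * G b c * v ν c) * A a b := by
    simp only [hV, hW, Fin.sum_univ_two, Finset.sum_mul, ← Finset.sum_add_distrib,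
      ← Finset.sum_neg_distrib]
    refine Finset.sum_congr rfl fun ν _ => ?_
    ring
  simp only [zero_smul, add_zero, hcontr]
  simp only [mul_assoc _ _ (A a _), ← Finset.mul_sum]
  ring

/-- For the Polyakov string, the 1-jet lift of the
worldsheet-diffeomorphism generator is Legendre-projectable onto the canonical
Hamiltonian lift: `(FL₀)_* X_ξ = Y°_ξ`, i.e. at every point `q` of `J¹π`
(where `det g < 0`), the pushforward of `X_ξ` by the restricted Legendre map
equals `Y°_ξ` at `FL₀(q)`. -/
theorem stmt19 (D : ℕ) (T : ℝ) (hT : 0 < T)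
    (ξ : Fin 2 → (Fin 2 → ℝ) → ℝ) (hξ : ∀ a, ContDiff ℝ (⊤:ℕ∞) (ξ a))
    (q : PolyJ D) (hdet : ((Matrix.of q.2.2.1)⁻¹).det < 0) :
    fderiv ℝ (FL0 D T) q (Xws D ξ q) = Yws D ξ (FL0 D T q) := by
  have hline := (differentiableAt_FL0 D T q hdet).hasFDerivAt.hasLineDerivAt (Xws D ξ q)
  refine HasDerivAt.unique hline ?_
  have haff {E : Type} [NormedAddCommGroup E] [NormedSpace ℝ E] (x y : E) :
      HasDerivAt (fun t : ℝ => x + t • y) y 0 := by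
    simpa using ((hasDerivAt_id (0 : ℝ)).smul_const y).const_add x
  refine (haff _ _).prodMk ((haff _ _).prodMk ((haff _ _).prodMk ?_))
  exact hasDerivAt_pi.2 fun a => hasDerivAt_pi.2 fun μ =>
    hasDerivAt_momentum D T q.2.2.1 (fun b c => dxi ξ b c q.1) q.2.2.2.1 hdet a μ
end
end
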